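/- Let X be a first-order Markov source on {1, …, m} with transition matrix P, let W = {w_1, …, w_m} be D-ary codewords with lengths l_i, D ≥ 2, uniquely decodable for X (the concatenation map is injective on producible finite sequences), and let Q be the m×m matrix with Q_{ij} = D^{-l_j} if P_{ij} > 0 and 0 otherwise, L the column vector with L_i = D^{-l_i}, and 1_m the all-ones vector. Then for every k ≥ 1, Lᵀ Q^{k−1} 1_m ≤ k · l_max, where l_max = max_i l_i. -/

import Mathlib

open Matrix

section WeightedChains

variable {α : Type*} [Fintype α] [DecidableEq α] (R : α → α → Prop) [DecidableRel R]

/-- The lists with `n + 1` entries that start at `i` and whose adjacent entries are related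
by `R`. -/
def chainsFrom : ℕ → α → Finset (List α)
  | 0, i => {[i]}
  | n + 1, i => (Finset.univ.filter (R i)).biUnion fun j => (chainsFrom n j).image (i :: ·)

variable {R}

theorem head?_of_mem_chainsFrom {n : ℕ} {i : α} {x : List α} (hx : x ∈ chainsFrom R n i) :
    x.head? = some i := by
  cases n <;> simp only [chainsFrom, Finset.mem_singleton, Finset.mem_biUnion,
    Finset.mem_image] at hx
  · simp [hx]
  · obtain ⟨j, -, y, -, rfl⟩ := hx
    rfl

theorem length_of_mem_chainsFrom {n : ℕ} {i : α} {x : List α} (hx : x ∈ chainsFrom R n i) :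
    x.length = n + 1 := by
  induction n generalizing i x with
  | zero => simp_all [chainsFrom]
  | succ n ih =>
    simp only [chainsFrom, Finset.mem_biUnion, Finset.mem_image] at hx
    obtain ⟨j, -, y, hy, rfl⟩ := hx
    simp [ih hy]

theorem isChain_of_mem_chainsFrom {n : ℕ} {i : α} {x : List α} (hx : x ∈ chainsFrom R n i) :
    x.IsChain R := by
  induction n generalizing i x with
  | zero => simp_all [chainsFrom]
  | succ n ih =>
    simp only [chainsFrom, Finset.mem_biUnion, Finset.mem_image, Finset.mem_filter,
      Finset.mem_univ, true_and] at hx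
    obtain ⟨j, hij, y, hy, rfl⟩ := hx
    refine List.isChain_cons.2 ⟨fun z hz => ?_, ih hy⟩
    rw [head?_of_mem_chainsFrom hy] at hz
    obtain rfl : j = z := by simpa using hz
    exact hij

theorem disjoint_chainsFrom {n : ℕ} {i j : α} (hij : i ≠ j) :
    Disjoint (chainsFrom R n i) (chainsFrom R n j) := by
  refine Finset.disjoint_left.2 fun x hi hj => hij ?_
  simpa [head?_of_mem_chainsFrom hi] using head?_of_mem_chainsFrom hj

theorem sum_chainsFrom {S : Type*} [CommSemiring S] (f : α → S) (n : ℕ) (i : α) :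
    ∑ x ∈ chainsFrom R n i, (x.map f).prod =
      f i * ((Matrix.of fun a b => if R a b then f b else 0) ^ n *ᵥ fun _ => 1) i := by
  induction n generalizing i with
  | zero => simp [chainsFrom]
  | succ n ih =>
    have hcons : Function.Injective (i :: · : List α → List α) := List.cons_injective
    rw [chainsFrom, Finset.sum_biUnion, pow_succ', ← Matrix.mulVec_mulVec]
    · simp_rw [Finset.sum_image hcons.injOn, List.map_cons, List.prod_cons, ← Finset.mul_sum, ih]
      rw [Finset.sum_filter]
      congr 1
      exact Finset.sum_congr rfl fun j _ => by simp
    · exact fun a _ b _ hab => (Finset.disjoint_image hcons).2 (disjoint_chainsFrom hab)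

end WeightedChains

theorem List.inv_pow_length_flatMap {α β : Type*} {K : Type*} [Semifield K] (d : K)
    (w : α → List β) (x : List α) :
    d⁻¹ ^ (x.flatMap w).length = (x.map fun i => d⁻¹ ^ (w i).length).prod := by
  induction x with
  | nil => simp
  | cons a x ih =>
    rw [List.flatMap_cons, List.length_append, pow_add, ih, List.map_cons, List.prod_cons]

theorem List.length_flatMap_le {α β : Type*} {w : α → List β} {c : ℕ}
    (hw : ∀ i, (w i).length ≤ c) (x : List α) : (x.flatMap w).length ≤ x.length * c := by
  induction x with
  | nil => simp
  | cons a x ih =>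
    have := hw a
    simp only [List.flatMap_cons, List.length_append, List.length_cons]
    linarith

/-- The total weight of a finite set of nonempty words over an alphabet with `D` letters is at
most the number of lengths they can take. -/
theorem sum_inv_card_pow_length_le {β : Type*} [Fintype β] (T : Finset (List β)) (N : ℕ)
    (hT : ∀ y ∈ T, y.length ∈ Finset.Icc 1 N) :
    ∑ y ∈ T, ((Fintype.card β : ℝ)⁻¹) ^ y.length ≤ N := by
  calc ∑ y ∈ T, ((Fintype.card β : ℝ)⁻¹) ^ y.length
      = ∑ s ∈ Finset.Icc 1 N, ∑ y ∈ T with y.length = s,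
          ((Fintype.card β : ℝ)⁻¹) ^ y.length :=
        (Finset.sum_fiberwise_of_maps_to hT _).symm
    _ ≤ ∑ _s ∈ Finset.Icc 1 N, (1 : ℝ) := by
        refine Finset.sum_le_sum fun s _ => ?_
        have hcard : ((T.filter fun y => y.length = s).card : ℝ) ≤ (Fintype.card β : ℝ) ^ s := by
          exact_mod_cast Finset.card_filter_length_eq_le
        calc ∑ y ∈ T with y.length = s, ((Fintype.card β : ℝ)⁻¹) ^ y.length
            = (T.filter fun y => y.length = s).card * ((Fintype.card β : ℝ) ^ s)⁻¹ := by
              rw [← nsmul_eq_mul, ← Finset.sum_const]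
              exact Finset.sum_congr rfl fun y hy => by
                rw [(Finset.mem_filter.1 hy).2, inv_pow]
          _ ≤ 1 := by
              rw [← div_eq_mul_inv]
              exact div_le_one_of_le₀ hcard (by positivity)
    _ = N := by simp

/-- **Inequality (3) in the proof of Theorem 2.** Let `X` be a first-order Markov source on
`{1, …, m}` with transition matrix `P`, and `w 0, …, w (m-1)` nonempty `D`-ary codewords
(`D ≥ 2`) with lengths `l i`, uniquely decodable for `X` (the concatenation map is injective
on producible finite sequences).  Let `Q` be the matrix with `Q i j = D ^ (-l j)` when
`P i j > 0` and `0` otherwise, `L` the vector with `L i = D ^ (-l i)`, and `1ₘ` the all-ones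
vector.  Then for every `k ≥ 1`, `Lᵀ Q^(k-1) 1ₘ ≤ k · l_max`, where `l_max = max_i l i`. -/
theorem dotProduct_pow_le_linear (m D : ℕ) (hD : 2 ≤ D)
    (P : Matrix (Fin m) (Fin m) ℝ)
    (hPnonneg : ∀ i j, 0 ≤ P i j) (hProw : ∀ i, ∑ j, P i j = 1)
    (w : Fin m → List (Fin D)) (hw : ∀ i, w i ≠ [])
    (l : Fin m → ℕ) (hl : ∀ i, l i = (w i).length)
    (hUD : Set.InjOn (fun x : List (Fin m) => x.flatMap w)
      {x : List (Fin m) | x.Chain' fun a b => 0 < P a b})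
    (Q : Matrix (Fin m) (Fin m) ℝ)
    (hQ : ∀ i j, Q i j = if 0 < P i j then (D : ℝ) ^ (-(l j : ℤ)) else 0)
    (k : ℕ) (hk : 1 ≤ k) :
    (fun i => (D : ℝ) ^ (-(l i : ℤ))) ⬝ᵥ ((Q ^ (k - 1)) *ᵥ fun _ => (1 : ℝ))
      ≤ (k : ℝ) * (Finset.univ.sup l : ℕ) := by
  classical
  obtain ⟨n, rfl⟩ : ∃ n, k = n + 1 := ⟨k - 1, by omega⟩
  let R : Fin m → Fin m → Prop := fun a b => 0 < P a b
  let A : Finset (List (Fin m)) := Finset.univ.biUnion (chainsFrom R n)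
  have hA : ∀ x ∈ A, x.length = n + 1 ∧ x.IsChain R := fun x hx => by
    obtain ⟨i, -, hi⟩ := Finset.mem_biUnion.1 hx
    exact ⟨length_of_mem_chainsFrom hi, isChain_of_mem_chainsFrom hi⟩
  have hinj : Set.InjOn (fun x : List (Fin m) => x.flatMap w) A :=
    hUD.mono fun x hx => (hA x hx).2
  have hweight : ∀ i, (D : ℝ) ^ (-(l i : ℤ)) = (D : ℝ)⁻¹ ^ (w i).length := fun i => by
    rw [hl, _root_.zpow_neg, zpow_natCast, inv_pow]
  have hQ' : Q = Matrix.of fun a b => if R a b then (D : ℝ)⁻¹ ^ (w b).length else 0 := by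
    ext a b
    rw [hQ, hweight, Matrix.of_apply]
  have hsum : (fun i => (D : ℝ) ^ (-(l i : ℤ))) ⬝ᵥ ((Q ^ n) *ᵥ fun _ => (1 : ℝ)) =
      ∑ y ∈ A.image (fun x => x.flatMap w), (D : ℝ)⁻¹ ^ y.length := by
    rw [Finset.sum_image hinj, Finset.sum_biUnion fun a _ b _ hab => disjoint_chainsFrom hab]
    simp_rw [List.inv_pow_length_flatMap, sum_chainsFrom, ← hQ', ← hweight]
    rfl
  have hlen : ∀ y ∈ A.image (fun x => x.flatMap w),
      y.length ∈ Finset.Icc 1 ((n + 1) * Finset.univ.sup l) := by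
    intro y hy
    obtain ⟨x, hx, rfl⟩ := Finset.mem_image.1 hy
    have hxlen := (hA x hx).1
    refine Finset.mem_Icc.2 ⟨?_, ?_⟩
    · obtain ⟨a, t, rfl⟩ := List.exists_cons_of_length_eq_add_one hxlen
      have := List.length_pos_of_ne_nil (hw a)
      simp only [List.flatMap_cons, List.length_append]
      omega
    · rw [← hxlen]
      exact List.length_flatMap_le
        (fun i => hl i ▸ Finset.le_sup (f := l) (Finset.mem_univ i)) x
  have hbound := sum_inv_card_pow_length_le _ _ hlen
  rw [Fintype.card_fin, ← hsum] at hbound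
  rw [Nat.add_sub_cancel]
  exact_mod_cast hbound
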